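/- Let {x_k}_{k=1}^m be an m-element frame for ℝⁿ which is injective. Then there exists ε > 0 such that every m-element frame {y_k}_{k=1}^m for ℝⁿ with Σ_{k=1}^m ‖x_k − y_k‖² < ε² is also injective. That is, the injective m-element frames form an open subset of the m-element frames for ℝⁿ. -/

import Mathlib

open scoped InnerProductSpace

/-- The injective `m`-element frames form an open subset of the
`m`-element frames for `ℝⁿ`: if `{x_k}` is an injective `m`-element frame,
then there is `ε > 0` such that every `m`-element frame `{y_k}` with
`Σ_k ‖x_k − y_k‖² < ε²` is injective. -/
theorem stmt_9 {n m : ℕ} (x : Fin m → EuclideanSpace ℝ (Fin n))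
    (hframe : ∃ A B : ℝ, 0 < A ∧ A ≤ B ∧ ∀ v : EuclideanSpace ℝ (Fin n),
      A * ‖v‖ ^ 2 ≤ ∑ k, ⟪v, x k⟫_ℝ ^ 2 ∧ ∑ k, ⟪v, x k⟫_ℝ ^ 2 ≤ B * ‖v‖ ^ 2)
    (hinj : ∀ T : EuclideanSpace ℝ (Fin n) →L[ℝ] EuclideanSpace ℝ (Fin n),
      IsSelfAdjoint T → (∀ k, ⟪T (x k), x k⟫_ℝ = 0) → T = 0) :
    ∃ ε : ℝ, 0 < ε ∧ ∀ y : Fin m → EuclideanSpace ℝ (Fin n),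
      (∃ A B : ℝ, 0 < A ∧ A ≤ B ∧ ∀ v : EuclideanSpace ℝ (Fin n),
        A * ‖v‖ ^ 2 ≤ ∑ k, ⟪v, y k⟫_ℝ ^ 2 ∧ ∑ k, ⟪v, y k⟫_ℝ ^ 2 ≤ B * ‖v‖ ^ 2) →
      ∑ k, ‖x k - y k‖ ^ 2 < ε ^ 2 →
      (∀ T : EuclideanSpace ℝ (Fin n) →L[ℝ] EuclideanSpace ℝ (Fin n),
        IsSelfAdjoint T → (∀ k, ⟪T (y k), y k⟫_ℝ = 0) → T = 0) := by
  set K : Set (EuclideanSpace ℝ (Fin n) →L[ℝ] EuclideanSpace ℝ (Fin n)) :=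
    Metric.sphere 0 1 ∩ {T | IsSelfAdjoint T} with hK
  have : ProperSpace (EuclideanSpace ℝ (Fin n) →L[ℝ] EuclideanSpace ℝ (Fin n)) :=
    FiniteDimensional.proper ℝ _
  have hKc : IsCompact K := by
    refine (isCompact_sphere _ _).inter_right ?_
    have : IsClosed {T : EuclideanSpace ℝ (Fin n) →L[ℝ] EuclideanSpace ℝ (Fin n) |
        star T = T} := isClosed_eq (ContinuousLinearMap.adjoint (𝕜 := ℝ)
          (E := EuclideanSpace ℝ (Fin n)) (F := EuclideanSpace ℝ (Fin n))).continuous continuous_id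
    exact this
  have hev : ∀ᶠ y in nhds x, ∀ T ∈ K, ∃ k, ⟪T (y k), y k⟫_ℝ ≠ 0 := by
    refine hKc.eventually_forall_of_forall_eventually ?_
    rintro T ⟨hT1, hT2⟩
    have hT0 : T ≠ 0 := by
      rintro rfl
      simp at hT1
    have : ∃ k, ⟪T (x k), x k⟫_ℝ ≠ 0 := by
      by_contra h
      push Not at h
      exact hT0 (hinj T hT2 h)
    obtain ⟨k, hk⟩ := this
    have hc : Continuous (fun z : (Fin m → EuclideanSpace ℝ (Fin n)) ×
        (EuclideanSpace ℝ (Fin n) →L[ℝ] EuclideanSpace ℝ (Fin n)) =>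
        ⟪z.2 (z.1 k), z.1 k⟫_ℝ) := by fun_prop
    filter_upwards [hc.continuousAt.eventually_ne hk] with z hz
    exact ⟨k, hz⟩
  obtain ⟨ε, hε, h⟩ := Metric.eventually_nhds_iff.1 hev
  refine ⟨ε, hε, fun y _ hy T hT hTy => ?_⟩
  by_contra hT0
  have hd : dist y x < ε := by
    rw [dist_pi_lt_iff hε]
    intro k
    rw [dist_comm, dist_eq_norm]
    refine lt_of_pow_lt_pow_left₀ 2 hε.le (lt_of_le_of_lt ?_ hy)
    exact Finset.single_le_sum (f := fun k => ‖x k - y k‖ ^ 2)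
      (fun i _ => by positivity) (Finset.mem_univ k)
  have hn : ‖T‖ ≠ 0 := norm_ne_zero_iff.2 hT0
  obtain ⟨k, hk⟩ := h hd (‖T‖⁻¹ • T) ⟨by simp [norm_smul, hn],
    IsSelfAdjoint.smul (IsSelfAdjoint.all _) hT⟩
  apply hk
  simp [real_inner_smul_left, hTy k]
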